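/- Let 𝒜 be a unital associative ℂ-algebra and let M : ℂ∖{0} → M₂(𝒜) satisfy the Yang–Baxter equation with the 6-vertex R-matrix. Let α, β, γ ∈ ℂ∖{0} with β² ∉ {1, q², q⁴}. Then for all λ, μ ∈ ℂ∖{0} with (λ/μ)² ∉ {1, q², q^{−2}}, the gauged monodromy entries satisfy: (i) A(λ|α,β,γ)A(μ|α,β/q,γ/q) = A(μ|α,β,γ)A(λ|α,β/q,γ/q); (ii) B(λ|α,β)B(μ|α,β/q) = B(μ|α,β)B(λ|α,β/q); (iii) A(λ|α,β,γ)B(μ|α,β/q) = [q(λ/μ − μ/λ)/(λq/μ − μ/(qλ))]·B(μ|α,β)A(λ|α,β/q,γq) + [((q − 1/q)μ/λ)/(λq/μ − μ/(qλ))]·A(μ|α,β,γ)B(λ|α,β/q). -/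

import Mathlib

/-- The 6-vertex `R`-matrix `R(x)` acting on `ℂ² ⊗ ℂ²` (basis indexed by
`Fin 2 × Fin 2`). -/
noncomputable def Rmat (q x : ℂ) : Matrix (Fin 2 × Fin 2) (Fin 2 × Fin 2) ℂ :=
  Matrix.of fun i j : Fin 2 × Fin 2 =>
    if i = j then (if i.1 = i.2 then q * x - (q * x)⁻¹ else x - x⁻¹)
    else if i.1 = j.2 ∧ i.2 = j.1 ∧ i.1 ≠ i.2 then q - q⁻¹
    else 0

/-- `W₁ = W ⊗ I₂` as a `4×4` matrix over `A`. -/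
noncomputable def kron1 {A : Type*} [Ring A] (W : Matrix (Fin 2) (Fin 2) A) :
    Matrix (Fin 2 × Fin 2) (Fin 2 × Fin 2) A :=
  Matrix.kroneckerMap (· * ·) W (1 : Matrix (Fin 2) (Fin 2) A)

/-- `W₂ = I₂ ⊗ W` as a `4×4` matrix over `A`. -/
noncomputable def kron2 {A : Type*} [Ring A] (W : Matrix (Fin 2) (Fin 2) A) :
    Matrix (Fin 2 × Fin 2) (Fin 2 × Fin 2) A :=
  Matrix.kroneckerMap (· * ·) (1 : Matrix (Fin 2) (Fin 2) A) W

/-- `M : ℂ∖{0} → M₂(𝒜)` satisfies the Yang–Baxter equation with the 6-vertex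
`R`-matrix: `R(λ/μ) M₁(λ) M₂(μ) = M₂(μ) M₁(λ) R(λ/μ)`. -/
def YBEq (q : ℂ) {A : Type*} [Ring A] [Algebra ℂ A]
    (M : ℂ → Matrix (Fin 2) (Fin 2) A) : Prop :=
  ∀ lam mu : ℂ, lam ≠ 0 → mu ≠ 0 →
    (Rmat q (lam / mu)).map (algebraMap ℂ A) * kron1 (M lam) * kron2 (M mu) =
      kron2 (M mu) * kron1 (M lam) * (Rmat q (lam / mu)).map (algebraMap ℂ A)

/-- The gauge matrix `G(μ|α,β) = [[1/(αβμ), β/(αμ)],[1,1]]`. -/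
noncomputable def Gmat (al be mu : ℂ) : Matrix (Fin 2) (Fin 2) ℂ :=
  !![(al * be * mu)⁻¹, be / (al * mu); 1, 1]

/-- The gauge matrix `Ḡ(μ|γ) = [[1/(μγ), 0],[1,1]]`. -/
noncomputable def Gbar (ga mu : ℂ) : Matrix (Fin 2) (Fin 2) ℂ :=
  !![(mu * ga)⁻¹, 0; 1, 1]

/-- The gauged monodromy matrix
`M(λ|α,β,γ) = G(λq^{1/2}|α,β)⁻¹ · M(λ) · Ḡ(λq^{1/2}|γ)`. -/
noncomputable def gaugedM (sq al be ga : ℂ) {A : Type*} [Ring A] [Algebra ℂ A]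
    (M : ℂ → Matrix (Fin 2) (Fin 2) A) (lam : ℂ) : Matrix (Fin 2) (Fin 2) A :=
  ((Gmat al be (lam * sq))⁻¹).map (algebraMap ℂ A) * M lam *
    (Gbar ga (lam * sq)).map (algebraMap ℂ A)

/-- The gauged entry `A(λ|α,β,γ)`. -/
noncomputable def gYA (sq al be ga : ℂ) {A : Type*} [Ring A] [Algebra ℂ A]
    (M : ℂ → Matrix (Fin 2) (Fin 2) A) (lam : ℂ) : A :=
  gaugedM sq al be ga M lam 0 0

/-- The gauged entry `B(λ|α,β)`; it does not depend on the inner gauge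
parameter `γ` (the second column of `Ḡ` is `(0,1)ᵗ`), so it is expressed via
`(G(λq^{1/2}|α,β)⁻¹ M(λ))₁₂`. -/
noncomputable def gYB (sq al be : ℂ) {A : Type*} [Ring A] [Algebra ℂ A]
    (M : ℂ → Matrix (Fin 2) (Fin 2) A) (lam : ℂ) : A :=
  (((Gmat al be (lam * sq))⁻¹).map (algebraMap ℂ A) * M lam) 0 1

set_option linter.all false

/-- Scaled 6-vertex weights (multiplied by `q l m`). -/
def scR (q l m : ℂ) (i j k n : Fin 2) : ℂ :=
  if i = k ∧ j = n then (if i = j then q ^ 2 * l ^ 2 - m ^ 2 else q * (l ^ 2 - m ^ 2))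
  else if i = n ∧ j = k ∧ i ≠ j then (q ^ 2 - 1) * (l * m) else 0

/-- Entrywise exchange relations with cleared denominators. -/
def Exch (q l m : ℂ) {A : Type*} [Ring A] [Algebra ℂ A] (L N : Matrix (Fin 2) (Fin 2) A) : Prop :=
  ∀ i j c d : Fin 2,
    scR q l m i j 0 0 • (L 0 c * N 0 d) + scR q l m i j 0 1 • (L 0 c * N 1 d)
      + scR q l m i j 1 0 • (L 1 c * N 0 d) + scR q l m i j 1 1 • (L 1 c * N 1 d)
    = scR q l m 0 0 c d • (N j 0 * L i 0) + scR q l m 0 1 c d • (N j 1 * L i 0)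
      + scR q l m 1 0 c d • (N j 0 * L i 1) + scR q l m 1 1 c d • (N j 1 * L i 1)

lemma Rmat_eq_scR (q l m : ℂ) (hq : q ≠ 0) (hl : l ≠ 0) (hm : m ≠ 0) (i j k n : Fin 2) :
    Rmat q (l / m) (i, j) (k, n) = (q * l * m)⁻¹ * scR q l m i j k n := by
  fin_cases i <;> fin_cases j <;> fin_cases k <;> fin_cases n <;>
    simp [Rmat, scR] <;> field_simp

set_option maxHeartbeats 4000000 in
lemma exch_of_YBEq {q l m : ℂ} (hq : q ≠ 0) (hl : l ≠ 0) (hm : m ≠ 0)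
    {A : Type*} [Ring A] [Algebra ℂ A] {M : ℂ → Matrix (Fin 2) (Fin 2) A} (hM : YBEq q M) :
    Exch q l m (M l) (M m) := by
  intro i j c d
  have h := congrFun (congrFun (hM l m hl hm) (i, j)) (c, d)
  have hk : q * l * m ≠ 0 := mul_ne_zero (mul_ne_zero hq hl) hm
  apply smul_right_injective A (inv_ne_zero hk)
  simp only [smul_add, smul_smul, ← Rmat_eq_scR q l m hq hl hm]
  simp only [Matrix.mul_apply, Fintype.sum_prod_type, Fin.sum_univ_two, kron1, kron2,
    Matrix.kroneckerMap_apply, Matrix.map_apply, Matrix.one_apply] at h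
  simp only [Algebra.smul_def]
  have hc (z : ℂ) (y : A) : y * algebraMap ℂ A z = algebraMap ℂ A z * y := (Algebra.commutes z y).symm
  fin_cases i <;> fin_cases j <;> fin_cases c <;> fin_cases d <;>
    (simp [hc, mul_assoc, add_assoc, add_mul, mul_add] at h ⊢
     refine Eq.trans ?_ h
     abel)

/-- Polynomial form of the gauged entry `B`. -/
def pB (a b y : ℂ) {A : Type*} [Ring A] [Algebra ℂ A] (X : Matrix (Fin 2) (Fin 2) A) : A :=
  (a * y) • X 0 1 - b • X 1 1

/-- Polynomial form of the gauged entry `A`. -/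
def pA (a b g y : ℂ) {A : Type*} [Ring A] [Algebra ℂ A] (X : Matrix (Fin 2) (Fin 2) A) : A :=
  (a * y) • X 0 0 - b • X 1 0 + (y * g) • ((a * y) • X 0 1 - b • X 1 1)

lemma gYB_eq {sq al be lam : ℂ} (hs : sq ≠ 0) (hal : al ≠ 0) (hbe : be ≠ 0) (hl : lam ≠ 0)
    (hb : 1 - be ^ 2 ≠ 0)
    {A : Type*} [Ring A] [Algebra ℂ A] (M : ℂ → Matrix (Fin 2) (Fin 2) A) :
    gYB sq al be M lam = (be / (1 - be ^ 2)) • pB (al * sq) be lam (M lam) := by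
  have hd : (al * be * (lam * sq))⁻¹ - be / (al * (lam * sq)) =
      (1 - be ^ 2) / (al * be * (lam * sq)) := by field_simp
  simp only [gYB, pB, Gmat, Matrix.inv_def, Matrix.det_fin_two_of, Matrix.adjugate_fin_two_of,
    Matrix.mul_apply, Fin.sum_univ_two, Matrix.map_apply, Matrix.smul_apply, mul_one, hd]
  simp [← Algebra.smul_def, Ring.inverse_eq_inv']
  match_scalars <;> field_simp

lemma gYA_eq {sq al be ga lam : ℂ} (hs : sq ≠ 0) (hal : al ≠ 0) (hbe : be ≠ 0) (hga : ga ≠ 0)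
    (hl : lam ≠ 0) (hb : 1 - be ^ 2 ≠ 0)
    {A : Type*} [Ring A] [Algebra ℂ A] (M : ℂ → Matrix (Fin 2) (Fin 2) A) :
    gYA sq al be ga M lam =
      (be / (1 - be ^ 2) / (lam * (ga * sq))) • pA (al * sq) be (ga * sq) lam (M lam) := by
  have hd : (al * be * (lam * sq))⁻¹ - be / (al * (lam * sq)) =
      (1 - be ^ 2) / (al * be * (lam * sq)) := by field_simp
  have hc (z : ℂ) (y : A) : y * algebraMap ℂ A z = algebraMap ℂ A z * y := (Algebra.commutes z y).symm
  simp only [gYA, gaugedM, pA, Gmat, Gbar, Matrix.inv_def, Matrix.det_fin_two_of,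
    Matrix.adjugate_fin_two_of,
    Matrix.mul_apply, Fin.sum_univ_two, Matrix.map_apply, Matrix.smul_apply, mul_one, hd, hc]
  simp only [← Algebra.smul_def, Ring.inverse_eq_inv']
  simp
  match_scalars <;> field_simp

section core
variable {q l m : ℂ} {A : Type*} [Ring A] [Algebra ℂ A] {L N : Matrix (Fin 2) (Fin 2) A}

set_option maxHeartbeats 4000000 in
lemma core1 (h : Exch q l m L N) (a b g : ℂ) :
    (q ^ 2 * l ^ 2 - m ^ 2) • (pA a (q * b) (q * g) l L * pA a b g m N) =
    (q ^ 2 * l ^ 2 - m ^ 2) • (pA a (q * b) (q * g) m N * pA a b g l L) := by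
  have h0000 := h 0 0 0 0
  have h0001 := h 0 0 0 1
  have h0010 := h 0 0 1 0
  have h0011 := h 0 0 1 1
  have h0100 := h 0 1 0 0
  have h0101 := h 0 1 0 1
  have h0110 := h 0 1 1 0
  have h0111 := h 0 1 1 1
  have h1000 := h 1 0 0 0
  have h1001 := h 1 0 0 1
  have h1010 := h 1 0 1 0
  have h1011 := h 1 0 1 1
  have h1100 := h 1 1 0 0
  have h1101 := h 1 1 0 1
  have h1110 := h 1 1 1 0
  have h1111 := h 1 1 1 1
  simp [scR] at h0000 h0001 h0010 h0011 h0100 h0101 h0110 h0111 h1000 h1001 h1010 h1011 h1100 h1101 h1110 h1111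
  simp only [pA, pB, add_mul, mul_add, sub_mul, mul_sub, smul_mul_assoc, mul_smul_comm, smul_add, smul_sub]
  linear_combination (norm := module) ((a*l)*(a*m) * (1*1)) • h0000
    + ((a*l)*(a*m) * (1*m*g)) • h0001
    + ((a*l)*(a*m) * (l*(q*g)*1)) • h0010
    + ((a*l)*(a*m) * (l*(q*g)*m*g)) • h0011
    + ((a*l)*(-(q*b)) * (1*1)) • h0100
    + ((a*l)*(-(q*b)) * (1*m*g)) • h0101
    + ((a*l)*(-(q*b)) * (l*(q*g)*1)) • h0110
    + ((a*l)*(-(q*b)) * (l*(q*g)*m*g)) • h0111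
    + ((-b)*(a*m) * (1*1)) • h1000
    + ((-b)*(a*m) * (1*m*g)) • h1001
    + ((-b)*(a*m) * (l*(q*g)*1)) • h1010
    + ((-b)*(a*m) * (l*(q*g)*m*g)) • h1011
    + ((-b)*(-(q*b)) * (1*1)) • h1100
    + ((-b)*(-(q*b)) * (1*m*g)) • h1101
    + ((-b)*(-(q*b)) * (l*(q*g)*1)) • h1110
    + ((-b)*(-(q*b)) * (l*(q*g)*m*g)) • h1111

set_option maxHeartbeats 4000000 in
lemma core2 (h : Exch q l m L N) (a b : ℂ) :
    (q ^ 2 * l ^ 2 - m ^ 2) • (pB a (q * b) l L * pB a b m N) =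
    (q ^ 2 * l ^ 2 - m ^ 2) • (pB a (q * b) m N * pB a b l L) := by
  have h0011 := h 0 0 1 1
  have h0111 := h 0 1 1 1
  have h1011 := h 1 0 1 1
  have h1111 := h 1 1 1 1
  simp [scR] at h0011 h0111 h1011 h1111
  simp only [pA, pB, add_mul, mul_add, sub_mul, mul_sub, smul_mul_assoc, mul_smul_comm, smul_add, smul_sub]
  linear_combination (norm := module) ((a*l)*(a*m) * (1)) • h0011
    + ((a*l)*(-(q*b)) * (1)) • h0111
    + ((-b)*(a*m) * (1)) • h1011
    + ((-b)*(-(q*b)) * (1)) • h1111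

set_option maxHeartbeats 4000000 in
lemma core3 (h : Exch q l m L N) (a b g : ℂ) :
    (q ^ 2 * l ^ 2 - m ^ 2) • (pA a (q * b) g l L * pB a b m N) =
    (q * (l ^ 2 - m ^ 2)) • (pB a (q * b) m N * pA a b (g * q) l L)
    + ((q ^ 2 - 1) * (l * m)) • (pA a (q * b) g m N * pB a b l L) := by
  have h0001 := h 0 0 0 1
  have h0011 := h 0 0 1 1
  have h0101 := h 0 1 0 1
  have h0111 := h 0 1 1 1
  have h1001 := h 1 0 0 1
  have h1011 := h 1 0 1 1
  have h1101 := h 1 1 0 1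
  have h1111 := h 1 1 1 1
  simp [scR] at h0001 h0011 h0101 h0111 h1001 h1011 h1101 h1111
  simp only [pA, pB, add_mul, mul_add, sub_mul, mul_sub, smul_mul_assoc, mul_smul_comm, smul_add, smul_sub]
  linear_combination (norm := module) ((a*l)*(a*m) * (1)) • h0001
    + ((a*l)*(a*m) * (l*g)) • h0011
    + ((a*l)*(-(q*b)) * (1)) • h0101
    + ((a*l)*(-(q*b)) * (l*g)) • h0111
    + ((-b)*(a*m) * (1)) • h1001
    + ((-b)*(a*m) * (l*g)) • h1011
    + ((-b)*(-(q*b)) * (1)) • h1101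
    + ((-b)*(-(q*b)) * (l*g)) • h1111

end core

/-- Gauged Yang–Baxter commutation relations for the entries of
the gauged monodromy matrix. -/
theorem stmt_19 (q sq : ℂ) (hq0 : q ≠ 0) (hsq : sq ^ 2 = q)
    (hqroot : ∀ n : ℕ, 1 ≤ n → n ≤ 8 → q ^ n ≠ 1)
    {A : Type*} [Ring A] [Algebra ℂ A]
    (M : ℂ → Matrix (Fin 2) (Fin 2) A) (hM : YBEq q M)
    (al be ga : ℂ) (hal : al ≠ 0) (hbe : be ≠ 0) (hga : ga ≠ 0)
    (hbe2 : be ^ 2 ∉ ({1, q ^ 2, q ^ 4} : Set ℂ)) :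
    ∀ lam mu : ℂ, lam ≠ 0 → mu ≠ 0 →
      (lam / mu) ^ 2 ∉ ({1, q ^ 2, (q ^ 2)⁻¹} : Set ℂ) →
      (gYA sq al be ga M lam * gYA sq al (be / q) (ga / q) M mu =
        gYA sq al be ga M mu * gYA sq al (be / q) (ga / q) M lam) ∧
      (gYB sq al be M lam * gYB sq al (be / q) M mu =
        gYB sq al be M mu * gYB sq al (be / q) M lam) ∧
      (gYA sq al be ga M lam * gYB sq al (be / q) M mu =
        (q * (lam / mu - mu / lam) / (lam * q / mu - mu / (q * lam))) •
          (gYB sq al be M mu * gYA sq al (be / q) (ga * q) M lam) +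
        ((q - q⁻¹) * (mu / lam) / (lam * q / mu - mu / (q * lam))) •
          (gYA sq al be ga M mu * gYB sq al (be / q) M lam)) := by
  intro lam mu hl hm hlm
  have hs : sq ≠ 0 := by
    rintro rfl
    exact hq0 (by rw [← hsq]; simp)
  simp only [Set.mem_insert_iff, Set.mem_singleton_iff, not_or] at hbe2 hlm
  have hb1 : 1 - be ^ 2 ≠ 0 := fun h => hbe2.1 (by linear_combination -h)
  have hb2 : 1 - (be / q) ^ 2 ≠ 0 := by
    intro h
    apply hbe2.2.1
    field_simp at h
    linear_combination -h
  have hP : q ^ 2 * lam ^ 2 - mu ^ 2 ≠ 0 := by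
    intro h
    apply hlm.2.2
    field_simp
    linear_combination h
  have hex := exch_of_YBEq hq0 hl hm hM
  have e : q * (be / q) = be := by field_simp
  have hbq : be / q ≠ 0 := div_ne_zero hbe hq0
  have hgq : ga / q ≠ 0 := div_ne_zero hga hq0
  have hgq2 : ga * q ≠ 0 := mul_ne_zero hga hq0
  rw [gYA_eq hs hal hbe hga hl hb1, gYA_eq hs hal hbe hga hm hb1,
    gYA_eq hs hal hbq hgq hl hb2, gYA_eq hs hal hbq hgq hm hb2,
    gYA_eq hs hal hbq hgq2 hl hb2,
    gYB_eq hs hal hbe hl hb1, gYB_eq hs hal hbe hm hb1,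
    gYB_eq hs hal hbq hl hb2, gYB_eq hs hal hbq hm hb2]
  have c1 := core1 hex (al * sq) (be / q) (ga / q * sq)
  have c2 := core2 hex (al * sq) (be / q)
  have c3 := core3 hex (al * sq) (be / q) (ga * sq)
  have e2 : q * (ga / q * sq) = ga * sq := by field_simp
  have e3 : ga * sq * q = ga * q * sq := by ring
  rw [e, e2] at c1
  rw [e] at c2
  rw [e, e3] at c3
  have c1c := smul_right_injective A hP c1
  have c2c := smul_right_injective A hP c2
  simp only [smul_mul_assoc, mul_smul_comm, smul_smul]
  refine ⟨?_, ?_, ?_⟩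
  · rw [c1c]
    congr 1
    ring
  · rw [c2c]
  · have hden : lam * q / mu - mu / (q * lam) = (q ^ 2 * lam ^ 2 - mu ^ 2) / (q * lam * mu) := by
      field_simp
    apply smul_right_injective A hP
    simp only [smul_add]
    rw [smul_comm, c3, hden]
    generalize 1 - (be / q) ^ 2 = z2 at *
    generalize 1 - be ^ 2 = z1 at *
    generalize hPP : q ^ 2 * lam ^ 2 - mu ^ 2 = PP at *
    match_scalars <;> field_simp
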